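/- Let n ≥ 3. The strong chromatic number of the associating hypergraph H on M(D_n,2), i.e., the minimum number k of colors in a coloring of the vertices such that any two distinct vertices lying in a common hyperedge of H receive different colors, equals 4n. -/

import Mathlib

/-- The operation of the Moufang loop `M(G,2)` on `G × ZMod 2`:
`(g₁,α₁) ∘ (g₂,α₂) = (g₁^(1-α₂) · g₂^((-1)^α₁) · g₁^α₂, α₁+α₂)`,
where the exponents use the integer representatives `0` and `1` of `ZMod 2`. -/
def Mop {G : Type*} [Group G] (a b : G × ZMod 2) : G × ZMod 2 :=
  (a.1 ^ (1 - (b.2.val : ℤ)) * b.1 ^ ((-1 : ℤ) ^ a.2.val) * a.1 ^ (b.2.val : ℤ),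
    a.2 + b.2)

/-- `x`, `y`, `z` associate in the order they are written. -/
def Assoc3 {G : Type*} [Group G] (x y z : G × ZMod 2) : Prop :=
  Mop (Mop x y) z = Mop x (Mop y z)

/-- `e` is a hyperedge of the associating hypergraph on `M(Dₙ,2)`: a set of three
pairwise distinct vertices that associate in some order. -/
def IsEdge {n : ℕ} (e : Finset (DihedralGroup n × ZMod 2)) : Prop :=
  ∃ a b c : DihedralGroup n × ZMod 2,
    a ≠ b ∧ a ≠ c ∧ b ≠ c ∧ e = {a, b, c} ∧ Assoc3 a b c

theorem one_mop {G : Type*} [Group G] (a : G × ZMod 2) : Mop (1, 0) a = a := by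
  simp [Mop]

theorem assoc3_one_left {G : Type*} [Group G] (a b : G × ZMod 2) : Assoc3 (1, 0) a b := by
  simp [Assoc3, one_mop]

/-- Any two distinct vertices lie in a common hyperedge, one containing the neutral element. -/
theorem exists_isEdge {n : ℕ} {u w : DihedralGroup n × ZMod 2} (h : u ≠ w) :
    ∃ e, IsEdge e ∧ u ∈ e ∧ w ∈ e := by
  have third : ∀ v : DihedralGroup n × ZMod 2,
      ∃ x, x ≠ (1, 0) ∧ v ≠ x := by
    intro v
    by_cases hx : v = (1, 1)
    · refine ⟨(DihedralGroup.sr 0, 0), ?_, ?_⟩ <;> simp [hx, DihedralGroup.one_def, -DihedralGroup.r_zero]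
    · exact ⟨(1, 1), by simp, hx⟩
  by_cases hu : u = (1, 0)
  · subst hu
    obtain ⟨x, hx, hwx⟩ := third w
    exact ⟨_, ⟨_, w, x, h, hx.symm, hwx, rfl, assoc3_one_left w x⟩, by simp, by simp⟩
  by_cases hw : w = (1, 0)
  · subst hw
    obtain ⟨x, hx, hux⟩ := third u
    exact ⟨_, ⟨_, u, x, h.symm, hx.symm, hux, rfl, assoc3_one_left u x⟩, by simp, by simp⟩
  exact ⟨_, ⟨_, u, w, Ne.symm hu, Ne.symm hw, h, rfl, assoc3_one_left u w⟩, by simp, by simp⟩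

theorem strong_chromatic_number (n : ℕ) (hn : 3 ≤ n) :
    IsLeast {k : ℕ | ∃ c : (DihedralGroup n × ZMod 2) → Fin k,
      ∀ e, IsEdge e → ∀ u ∈ e, ∀ w ∈ e, u ≠ w → c u ≠ c w} (4 * n) := by
  have : NeZero n := ⟨by omega⟩
  have hcard : Fintype.card (DihedralGroup n × ZMod 2) = 4 * n := by
    rw [Fintype.card_prod, DihedralGroup.card, ZMod.card]
    ring
  constructor
  · exact ⟨Fintype.equivFinOfCardEq hcard, fun e _ u _ w _ huw =>
      (Fintype.equivFinOfCardEq hcard).injective.ne huw⟩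
  · rintro k ⟨c, hc⟩
    have hinj : Function.Injective c := by
      intro u w huw
      by_contra h
      obtain ⟨e, he, hu, hw⟩ := exists_isEdge h
      exact hc e he u hu w hw h huw
    simpa [hcard] using Fintype.card_le_of_injective c hinj
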